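/- arXiv:2506.02640 — 3 statements merged into one kernel-verified Lean document; each statement's English description precedes it below -/
import Mathlib

section
/- Let r > 2 and let Γ = (0,1)² \ (S₁((0,1)²) ∪ S₂((0,1)²) ∪ S₃((0,1)²) ∪ S₄((0,1)²)), and let g = sup_{x ∈ Γ} dist(x, C^r). Then C^r is not pluriphase with respect to Γ: there do not exist an integer M ≥ 1, a partition 0 = a₀ < a₁ < … < a_M = g, and real constants κ_{m,k} (1 ≤ m ≤ M, 0 ≤ k ≤ 2) such that for all ε > 0 one has λ²((C^r)_ε ∩ Γ) = Σ_{m=1}^M 1_{(a_{m−1}, a_m]}(ε) · Σ_{k=0}^2 κ_{m,k} ε^(2−k) + 1_{(g,∞)}(ε) · λ²(Γ). -/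
open MeasureTheory Metric Set Real Filter Topology ENNReal

/-- The similarity map `x ↦ x/r + (a, b)` of the plane. -/
noncomputable def cantorMap (r a b : ℝ) (x : EuclideanSpace ℝ (Fin 2)) :
    EuclideanSpace ℝ (Fin 2) :=
  r⁻¹ • x + (WithLp.equiv 2 (Fin 2 → ℝ)).symm ![a, b]

/-- `C` is the Cantor dust with parameter `r`: the (unique) nonempty compact set invariant
under the four similarities `S₁, S₂, S₃, S₄`. -/
def IsCantorDust (r : ℝ) (C : Set (EuclideanSpace ℝ (Fin 2))) : Prop :=
  IsCompact C ∧ C.Nonempty ∧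
    C = cantorMap r 0 0 '' C ∪ cantorMap r ((r - 1) / r) 0 '' C ∪
        cantorMap r ((r - 1) / r) ((r - 1) / r) '' C ∪ cantorMap r 0 ((r - 1) / r) '' C

/-- The open unit square `(0,1)²`. -/
def openSquare : Set (EuclideanSpace ℝ (Fin 2)) :=
  {x | 0 < x 0 ∧ x 0 < 1 ∧ 0 < x 1 ∧ x 1 < 1}

/-- `Γ = (0,1)² \ (S₁((0,1)²) ∪ S₂((0,1)²) ∪ S₃((0,1)²) ∪ S₄((0,1)²))`. -/
noncomputable def Gamma (r : ℝ) : Set (EuclideanSpace ℝ (Fin 2)) :=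
  openSquare \
    (cantorMap r 0 0 '' openSquare ∪ cantorMap r ((r - 1) / r) 0 '' openSquare ∪
     cantorMap r ((r - 1) / r) ((r - 1) / r) '' openSquare ∪
     cantorMap r 0 ((r - 1) / r) '' openSquare)

@[simp] lemma cantorMap_apply_zero (r a b : ℝ) (x : EuclideanSpace ℝ (Fin 2)) :
    cantorMap r a b x 0 = r⁻¹ * x 0 + a := by
  simp [cantorMap]

@[simp] lemma cantorMap_apply_one (r a b : ℝ) (x : EuclideanSpace ℝ (Fin 2)) :
    cantorMap r a b x 1 = r⁻¹ * x 1 + b := by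
  simp [cantorMap]

lemma euclidean_two_ext {x y : EuclideanSpace ℝ (Fin 2)} (h0 : x 0 = y 0) (h1 : x 1 = y 1) :
    x = y := by
  ext i
  fin_cases i <;> assumption

/-- A point belongs to the image of the open unit square iff both its coordinates lie strictly
between those of opposite corners of the image. -/
lemma mem_cantorMap_image_openSquare {r : ℝ} (hr : 0 < r) {a b : ℝ}
    {x : EuclideanSpace ℝ (Fin 2)} :
    x ∈ cantorMap r a b '' openSquare ↔
      (a < x 0 ∧ x 0 < a + r⁻¹) ∧ (b < x 1 ∧ x 1 < b + r⁻¹) := by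
  have hr' : 0 < r⁻¹ := inv_pos.mpr hr
  constructor
  · rintro ⟨y, ⟨h1, h2, h3, h4⟩, rfl⟩
    simp only [cantorMap_apply_zero, cantorMap_apply_one]
    refine ⟨⟨?_, ?_⟩, ?_, ?_⟩ <;> nlinarith
  · rintro ⟨⟨h1, h2⟩, h3, h4⟩
    have key : ∀ u : ℝ, 0 < u → u < r⁻¹ → 0 < r * u ∧ r * u < 1 := fun u hu hu' =>
      ⟨by positivity, by
        calc r * u < r * r⁻¹ := by gcongr
          _ = 1 := mul_inv_cancel₀ hr.ne'⟩
    obtain ⟨k1, k2⟩ := key (x 0 - a) (by linarith) (by linarith)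
    obtain ⟨k3, k4⟩ := key (x 1 - b) (by linarith) (by linarith)
    refine ⟨!₂[r * (x 0 - a), r * (x 1 - b)], ⟨by simpa using k1, by simpa using k2,
      by simpa using k3, by simpa using k4⟩, ?_⟩
    apply euclidean_two_ext
    · simp; field_simp; ring
    · simp; field_simp; ring

lemma mem_Gamma {r : ℝ} {x : EuclideanSpace ℝ (Fin 2)} :
    x ∈ _root_.Gamma r ↔ x ∈ openSquare ∧ ∀ a b, (a = 0 ∨ a = (r - 1) / r) →
      (b = 0 ∨ b = (r - 1) / r) → x ∉ cantorMap r a b '' openSquare := by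
  constructor
  · rintro ⟨h, h'⟩
    simp only [mem_union, not_or] at h'
    refine ⟨h, ?_⟩
    rintro a b (rfl | rfl) (rfl | rfl) <;> tauto
  · rintro ⟨h, h'⟩
    refine ⟨h, ?_⟩
    rintro (((h1 | h1) | h1) | h1) <;> exact h' _ _ (by simp) (by simp) h1

namespace IsCantorDust

variable {r : ℝ} {C : Set (EuclideanSpace ℝ (Fin 2))}

lemma mem_iff (hC : IsCantorDust r C) {c : EuclideanSpace ℝ (Fin 2)} :
    c ∈ C ↔ ∃ a b, (a = 0 ∨ a = (r - 1) / r) ∧ (b = 0 ∨ b = (r - 1) / r) ∧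
      ∃ c' ∈ C, cantorMap r a b c' = c := by
  constructor
  · intro h
    rw [hC.2.2] at h
    rcases h with ((h | h) | h) | h <;> exact ⟨_, _, by simp, by simp, h⟩
  · rintro ⟨a, b, ha, hb, h⟩
    rw [hC.2.2]
    simp only [mem_union]
    rcases ha with rfl | rfl <;> rcases hb with rfl | rfl
    exacts [.inl (.inl (.inl h)), .inr h, .inl (.inl (.inr h)), .inl (.inr h)]

lemma cantorMap_mem (hC : IsCantorDust r C) {a b : ℝ} (ha : a = 0 ∨ a = (r - 1) / r)
    (hb : b = 0 ∨ b = (r - 1) / r) {c : EuclideanSpace ℝ (Fin 2)} (hc : c ∈ C) :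
    cantorMap r a b c ∈ C :=
  hC.mem_iff.mpr ⟨a, b, ha, hb, c, hc, rfl⟩

end IsCantorDust

lemma isCompact_coord_image {C : Set (EuclideanSpace ℝ (Fin 2))} (hC : IsCompact C) (i : Fin 2) :
    IsCompact ((fun x => x i) '' C) :=
  hC.image (by fun_prop)

/-- A compact subset of the line contained in the union of its two contracted copies lies in the
unit interval. -/
lemma subset_Icc_of_self_similar {r : ℝ} (hr : 2 < r) {K : Set ℝ} (hK : IsCompact K)
    (h : ∀ t ∈ K, ∃ a, (a = 0 ∨ a = (r - 1) / r) ∧ ∃ s ∈ K, r⁻¹ * s + a = t) :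
    K ⊆ Icc 0 1 := by
  rcases K.eq_empty_or_nonempty with rfl | hne
  · simp
  have hr' : 0 < r⁻¹ := by positivity
  have hr1 : r⁻¹ < 1 := inv_lt_one_of_one_lt₀ (by linarith)
  have hρ : (r - 1) / r = 1 - r⁻¹ := by field_simp
  obtain ⟨m, hm, hmin⟩ := hK.exists_isLeast hne
  obtain ⟨M, hM, hmax⟩ := hK.exists_isGreatest hne
  have h0 : 0 ≤ m := by
    obtain ⟨a, ha, s, hs, hsm⟩ := h m hm
    have := hmin hs
    have : 0 ≤ a := by rcases ha with rfl | rfl <;> linarith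
    nlinarith
  have h1 : M ≤ 1 := by
    obtain ⟨a, ha, s, hs, hsm⟩ := h M hM
    have := hmax hs
    have : a ≤ 1 - r⁻¹ := by rcases ha with rfl | rfl <;> linarith
    nlinarith
  exact fun t ht => ⟨h0.trans (hmin ht), (hmax ht).trans h1⟩

open scoped Pointwise in
/-- A compact subset of the line contained in the union of its two copies contracted by a factor
smaller than `1/2` is Lebesgue null. -/
lemma volume_eq_zero_of_self_similar {r : ℝ} (hr : 2 < r) {K : Set ℝ} (hK : IsCompact K)
    (h : ∀ t ∈ K, ∃ a, (a = 0 ∨ a = (r - 1) / r) ∧ ∃ s ∈ K, r⁻¹ * s + a = t) :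
    volume K = 0 := by
  have hr' : 0 < r⁻¹ := by positivity
  have hcopy : ∀ a : ℝ, volume ((fun s => r⁻¹ * s + a) '' K) = ENNReal.ofReal r⁻¹ * volume K := by
    intro a
    have : (fun s => r⁻¹ * s + a) '' K = (fun s => s + a) '' (r⁻¹ • K) := by
      rw [← image_smul, image_image]; rfl
    rw [this, image_add_right, measure_preimage_add_right, Measure.addHaar_smul]
    simp [abs_of_pos (show 0 < r by linarith)]
  have hsub : K ⊆ (fun s => r⁻¹ * s + 0) '' K ∪ (fun s => r⁻¹ * s + (r - 1) / r) '' K := by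
    intro t ht
    obtain ⟨a, rfl | rfl, hs⟩ := h t ht
    exacts [.inl hs, .inr hs]
  have hle := (measure_mono hsub).trans (measure_union_le (μ := volume) _ _)
  rw [hcopy, hcopy] at hle
  have hfin : volume K ≠ ⊤ := hK.measure_lt_top.ne
  have hreal := ENNReal.toReal_mono (by finiteness) hle
  rw [ENNReal.toReal_add (by finiteness) (by finiteness), ENNReal.toReal_mul,
    ENNReal.toReal_ofReal hr'.le] at hreal
  have h2 : r⁻¹ < 2⁻¹ := inv_strictAnti₀ (by norm_num) hr
  have h3 : 0 ≤ (volume K).toReal := ENNReal.toReal_nonneg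
  have : (volume K).toReal = 0 := by nlinarith
  exact (ENNReal.toReal_eq_zero_iff _).mp this |>.resolve_right hfin

lemma IsCantorDust.coord_self_similar {r : ℝ} {C : Set (EuclideanSpace ℝ (Fin 2))}
    (hC : IsCantorDust r C) (i : Fin 2) :
    ∀ t ∈ (fun x : EuclideanSpace ℝ (Fin 2) => x i) '' C, ∃ a, (a = 0 ∨ a = (r - 1) / r) ∧
      ∃ s ∈ (fun x : EuclideanSpace ℝ (Fin 2) => x i) '' C, r⁻¹ * s + a = t := by
  rintro _ ⟨c, hc, rfl⟩
  obtain ⟨a, b, ha, hb, c', hc', rfl⟩ := hC.mem_iff.mp hc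
  fin_cases i
  · exact ⟨a, ha, _, ⟨c', hc', rfl⟩, by simp⟩
  · exact ⟨b, hb, _, ⟨c', hc', rfl⟩, by simp⟩

lemma IsCantorDust.coord_mem_Icc {r : ℝ} (hr : 2 < r) {C : Set (EuclideanSpace ℝ (Fin 2))}
    (hC : IsCantorDust r C) {c : EuclideanSpace ℝ (Fin 2)} (hc : c ∈ C) (i : Fin 2) :
    c i ∈ Icc (0 : ℝ) 1 :=
  subset_Icc_of_self_similar hr (isCompact_coord_image hC.1 i) (hC.coord_self_similar i)
    ⟨c, hc, rfl⟩

lemma volume_box (s t : Set ℝ) :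
    volume {x : EuclideanSpace ℝ (Fin 2) | x 0 ∈ s ∧ x 1 ∈ t} = volume s * volume t := by
  have : {x : EuclideanSpace ℝ (Fin 2) | x 0 ∈ s ∧ x 1 ∈ t} =
      (MeasurableEquiv.toLp 2 (Fin 2 → ℝ)).symm ⁻¹' (univ.pi ![s, t]) := by
    ext x
    simp [Set.mem_pi, Fin.forall_fin_two]
  rw [this, MeasurePreserving.measure_preimage_equiv
      (EuclideanSpace.volume_preserving_symm_measurableEquiv_toLp (Fin 2)),
    volume_pi, Measure.pi_pi]
  simp [Fin.prod_univ_two]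

lemma volume_openSquare : volume openSquare = 1 := by
  have : openSquare = {x | x 0 ∈ Ioo (0 : ℝ) 1 ∧ x 1 ∈ Ioo (0 : ℝ) 1} := by
    ext x; simp [openSquare, and_assoc]
  rw [this, volume_box]; simp

lemma volume_inter_Gamma_ne_top (r : ℝ) (A : Set (EuclideanSpace ℝ (Fin 2))) :
    volume (A ∩ Gamma r) ≠ ⊤ := by
  refine ((measure_mono (inter_subset_right.trans sdiff_subset)).trans_lt ?_).ne
  rw [volume_openSquare]; exact ENNReal.one_lt_top

/-- The points of the Cantor dust accumulating at `(1/r, 0)` along the vertical edge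
`x 0 = 1/r`. -/
lemma IsCantorDust.edge_mem {r : ℝ} (hr : 2 < r) {C : Set (EuclideanSpace ℝ (Fin 2))}
    (hC : IsCantorDust r C) (n : ℕ) : ∃ c ∈ C, c 0 = r⁻¹ ∧ c 1 = r⁻¹ ^ (n + 1) := by
  have hr1 : r⁻¹ < 1 := inv_lt_one_of_one_lt₀ (by linarith)
  have hρ : (r - 1) / r = 1 - r⁻¹ := by field_simp
  have right : ∃ c ∈ C, c 0 = 1 ∧ c 1 = r⁻¹ ^ n := by
    induction n with
    | zero =>
      obtain ⟨c, hc, hmax⟩ := hC.1.exists_isMaxOn hC.2.1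
        (f := fun x : EuclideanSpace ℝ (Fin 2) => x 0 + x 1) (by fun_prop)
      have h := hmax (hC.cantorMap_mem (.inr rfl) (.inr rfl) hc)
      simp only [mem_ofPred_eq, cantorMap_apply_zero, cantorMap_apply_one, hρ] at h
      have h0 := (hC.coord_mem_Icc hr hc 0).2
      have h1 := (hC.coord_mem_Icc hr hc 1).2
      have h2 : 2 ≤ c 0 + c 1 := by nlinarith
      exact ⟨c, hc, by linarith, by simp; linarith⟩
    | succ n ih =>
      obtain ⟨c, hc, h0, h1⟩ := ih
      exact ⟨_, hC.cantorMap_mem (.inr rfl) (.inl rfl) hc, by simp [h0, hρ],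
        by simp [h1, pow_succ']⟩
  obtain ⟨c, hc, h0, h1⟩ := right
  exact ⟨_, hC.cantorMap_mem (.inl rfl) (.inl rfl) hc, by simp [h0], by simp [h1, pow_succ']⟩

/-- Many pairwise disjoint small squares fit into the parallel set inside `Γ`. -/
lemma IsCantorDust.eventually_le_volume {r : ℝ} (hr : 2 < r)
    {C : Set (EuclideanSpace ℝ (Fin 2))} (hC : IsCantorDust r C) (N : ℕ) :
    ∀ᶠ ε in 𝓝[>] (0 : ℝ), N * (ε / 2) ^ 2 ≤ (volume (cthickening ε C ∩ Gamma r)).toReal := by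
  have hr' : 0 < r⁻¹ := by positivity
  have hr2 : r⁻¹ < 2⁻¹ := inv_strictAnti₀ (by norm_num) hr
  have hρ : (r - 1) / r = 1 - r⁻¹ := by field_simp
  have hu : 0 < min (1 - 2 * r⁻¹) (r⁻¹ ^ (N + 1)) := lt_min (by linarith) (by positivity)
  filter_upwards [Ioo_mem_nhdsGT hu] with ε ⟨hε, hεu⟩
  have hε1 := hεu.trans_le (min_le_left _ _)
  have hε2 := hεu.trans_le (min_le_right _ _)
  have hpow : ∀ n < N, r⁻¹ ^ (N + 1) ≤ r⁻¹ ^ (n + 2) := fun n hn =>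
    pow_le_pow_of_le_one hr'.le (by linarith) (by lia)
  set I : ℕ → Set ℝ := fun n => Ioo (r⁻¹ ^ (n + 1) - ε / 2) (r⁻¹ ^ (n + 1)) with hI
  set Q : ℕ → Set (EuclideanSpace ℝ (Fin 2)) := fun n =>
    {x | x 0 ∈ Ioo r⁻¹ (r⁻¹ + ε / 2) ∧ x 1 ∈ I n} with hQ
  have hQvol : ∀ n, volume (Q n) = ENNReal.ofReal ((ε / 2) ^ 2) := by
    intro n
    rw [hQ, volume_box, Real.volume_Ioo, Real.volume_Ioo, ← ENNReal.ofReal_mul (by linarith)]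
    congr 1; ring
  have hstep : ∀ n < N, ∀ m, n < m → r⁻¹ ^ (m + 1) ≤ r⁻¹ ^ (n + 1) - ε / 2 := by
    intro n hn m hnm
    have h1 : r⁻¹ ^ (m + 1) ≤ r⁻¹ ^ (n + 2) :=
      pow_le_pow_of_le_one hr'.le (by linarith) (by lia)
    have h2 := hpow n hn
    have h3 : r⁻¹ ^ (n + 2) = r⁻¹ ^ (n + 1) * r⁻¹ := pow_succ _ _
    have h4 : 0 < r⁻¹ ^ (n + 1) := by positivity
    nlinarith
  have hdisj : ((Finset.range N : Finset ℕ) : Set ℕ).PairwiseDisjoint Q := by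
    intro n hn m hm hnm
    rw [Function.onFun, Set.disjoint_left]
    rintro x ⟨-, hx1, hx2⟩ ⟨-, hx3, hx4⟩
    simp only [Finset.coe_range, mem_Iio] at hn hm
    rcases lt_or_gt_of_ne hnm with h | h
    · linarith [hstep n hn m h]
    · linarith [hstep m hm n h]
  have hmeas : ∀ n, MeasurableSet (Q n) := fun n =>
    (measurableSet_Ioo.preimage
        (by fun_prop : Measurable fun x : EuclideanSpace ℝ (Fin 2) => x 0)).inter
      (measurableSet_Ioo.preimage
        (by fun_prop : Measurable fun x : EuclideanSpace ℝ (Fin 2) => x 1))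
  have hsub : (⋃ n ∈ Finset.range N, Q n) ⊆ cthickening ε C ∩ Gamma r := by
    simp only [Finset.mem_range, iUnion_subset_iff]
    rintro n hn x ⟨⟨hx1, hx2⟩, hx3, hx4⟩
    have h2 := hpow n hn
    have h3 : r⁻¹ ^ (n + 2) ≤ r⁻¹ ^ (n + 1) :=
      pow_le_pow_of_le_one hr'.le (by linarith) (by lia)
    have h4 : r⁻¹ ^ (n + 1) ≤ 1 := pow_le_one₀ hr'.le (by linarith)
    obtain ⟨c, hc, hc0, hc1⟩ := hC.edge_mem hr n
    refine ⟨mem_cthickening_of_dist_le x c ε C hc ?_, mem_Gamma.mpr ⟨⟨?_, ?_, ?_, ?_⟩, ?_⟩⟩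
    · rw [EuclideanSpace.dist_eq, Fin.sum_univ_two, Real.dist_eq, Real.dist_eq, sq_abs, sq_abs,
        hc0, hc1]
      apply Real.sqrt_le_iff.mpr
      constructor
      · exact hε.le
      · nlinarith
    · linarith
    · linarith
    · linarith
    · linarith
    · rintro a b ha - hx
      rw [mem_cantorMap_image_openSquare (by linarith)] at hx
      rcases ha with rfl | rfl
      · linarith [hx.1.2]
      · linarith [hx.1.1]
  have hle := measure_mono (μ := volume) hsub
  rw [measure_biUnion_finset hdisj fun n _ => hmeas n] at hle
  simp only [hQvol, Finset.sum_const, Finset.card_range] at hle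
  have := ENNReal.toReal_mono (volume_inter_Gamma_ne_top r _) hle
  rwa [nsmul_eq_mul, ENNReal.toReal_mul, ENNReal.toReal_ofReal (by positivity),
    ENNReal.toReal_natCast] at this

/-- The parallel set inside `Γ` is covered by thin strips over thickened coordinate projections. -/
lemma IsCantorDust.volume_le {r : ℝ} (hr : 2 < r) {C : Set (EuclideanSpace ℝ (Fin 2))}
    (hC : IsCantorDust r C) {ε : ℝ} (hε : 0 < ε) :
    volume (cthickening ε C ∩ Gamma r) ≤ ENNReal.ofReal (8 * ε) *
      (volume (cthickening ε ((fun x => x 0) '' C)) +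
        volume (cthickening ε ((fun x => x 1) '' C))) := by
  have hr' : 0 < r⁻¹ := by positivity
  have hρ : (r - 1) / r = 1 - r⁻¹ := by field_simp
  set T : Set ℝ := (closedBall 0 ε ∪ closedBall r⁻¹ ε) ∪ (closedBall (1 - r⁻¹) ε ∪ closedBall 1 ε)
    with hT
  have hTvol : volume T ≤ ENNReal.ofReal (8 * ε) := by
    refine (measure_union_le _ _).trans <|
      (add_le_add (measure_union_le _ _) (measure_union_le _ _)).trans_eq ?_
    simp only [Real.volume_closedBall]
    rw [← ENNReal.ofReal_add (by positivity) (by positivity),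
      ← ENNReal.ofReal_add (by positivity) (by positivity)]
    congr 1; ring
  have hend : ∀ a s t : ℝ, (a = 0 ∨ a = (r - 1) / r) → s ∈ Icc (0 : ℝ) 1 →
      dist t (r⁻¹ * s + a) ≤ ε → ¬ (a < t ∧ t < a + r⁻¹) → t ∈ T := by
    rintro a s t ha ⟨hs0, hs1⟩ hd hn
    have hs2 : 0 ≤ r⁻¹ * s := by positivity
    have hs3 : r⁻¹ * s ≤ r⁻¹ := mul_le_of_le_one_right hr'.le hs1
    rw [Real.dist_eq, abs_le] at hd
    have hclose : t ∈ closedBall a ε ∨ t ∈ closedBall (a + r⁻¹) ε := by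
      simp only [mem_closedBall, Real.dist_eq, abs_le]
      rcases le_or_gt t a with h | h
      · left; constructor <;> linarith
      · right
        have : a + r⁻¹ ≤ t := by by_contra! h'; exact hn ⟨h, h'⟩
        constructor <;> linarith
    rw [hρ] at ha
    rcases ha with rfl | rfl <;> rcases hclose with h | h
    · exact .inl (.inl h)
    · exact .inl (.inr (by simpa using h))
    · exact .inr (.inl h)
    · exact .inr (.inr (by simpa using h))
  have hsub : cthickening ε C ∩ Gamma r ⊆
      {x | x 0 ∈ T ∧ x 1 ∈ cthickening ε ((fun x => x 1) '' C)} ∪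
      {x | x 0 ∈ cthickening ε ((fun x => x 0) '' C) ∧ x 1 ∈ T} := by
    rintro x ⟨hx, hxΓ⟩
    rw [hC.1.cthickening_eq_biUnion_closedBall hε.le] at hx
    simp only [mem_iUnion, mem_closedBall, exists_prop] at hx
    obtain ⟨c, hc, hd⟩ := hx
    have hd0 := (PiLp.dist_apply_le x c 0).trans hd
    have hd1 := (PiLp.dist_apply_le x c 1).trans hd
    have k0 := mem_cthickening_of_dist_le _ _ _ _
      (mem_image_of_mem (fun x : EuclideanSpace ℝ (Fin 2) => x 0) hc) hd0
    have k1 := mem_cthickening_of_dist_le _ _ _ _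
      (mem_image_of_mem (fun x : EuclideanSpace ℝ (Fin 2) => x 1) hc) hd1
    obtain ⟨a, b, ha, hb, c', hc', rfl⟩ := hC.mem_iff.mp hc
    have hout := (mem_Gamma.mp hxΓ).2 a b ha hb
    rw [mem_cantorMap_image_openSquare (by linarith), not_and_or] at hout
    rw [cantorMap_apply_zero] at hd0
    rw [cantorMap_apply_one] at hd1
    rcases hout with h | h
    · exact .inl ⟨hend a _ _ ha (hC.coord_mem_Icc hr hc' 0) hd0 h, k1⟩
    · exact .inr ⟨k0, hend b _ _ hb (hC.coord_mem_Icc hr hc' 1) hd1 h⟩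
  refine (measure_mono hsub).trans <| (measure_union_le _ _).trans ?_
  rw [volume_box, volume_box, mul_add, add_comm]
  rw [mul_comm (volume (cthickening _ _)) (volume T)]
  gcongr

lemma IsCantorDust.tendsto_volume_div {r : ℝ} (hr : 2 < r)
    {C : Set (EuclideanSpace ℝ (Fin 2))} (hC : IsCantorDust r C) :
    Tendsto (fun ε => (volume (cthickening ε C ∩ Gamma r)).toReal / ε) (𝓝[>] (0 : ℝ)) (𝓝 0) := by
  have hK : ∀ i : Fin 2, Tendsto
      (fun ε => (volume (cthickening ε
        ((fun x : EuclideanSpace ℝ (Fin 2) => x i) '' C))).toReal) (𝓝[>] (0 : ℝ)) (𝓝 0) := by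
    intro i
    have hcomp := isCompact_coord_image hC.1 i
    have h := tendsto_measure_cthickening_of_isCompact (μ := volume) hcomp
    rw [volume_eq_zero_of_self_similar hr hcomp (hC.coord_self_similar i)] at h
    simpa [Function.comp_def] using
      ((ENNReal.tendsto_toReal ENNReal.zero_ne_top).comp h).mono_left
        (nhdsWithin_le_nhds (s := Ioi 0))
  have hlim := ((hK 0).add (hK 1)).const_mul 8
  rw [add_zero, mul_zero] at hlim
  refine tendsto_of_tendsto_of_tendsto_of_le_of_le' tendsto_const_nhds hlim ?_ ?_
  · filter_upwards [self_mem_nhdsWithin] with ε (hε : 0 < ε)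
    positivity
  · filter_upwards [self_mem_nhdsWithin] with ε (hε : 0 < ε)
    have hfin : ∀ i : Fin 2, volume (cthickening ε
        ((fun x : EuclideanSpace ℝ (Fin 2) => x i) '' C)) ≠ ⊤ := fun i =>
      (isCompact_coord_image hC.1 i).cthickening.measure_lt_top.ne
    have h0 := hfin 0
    have h1 := hfin 1
    have h := ENNReal.toReal_mono (by finiteness) (hC.volume_le hr hε)
    rw [ENNReal.toReal_mul, ENNReal.toReal_ofReal (by positivity), ENNReal.toReal_add h0 h1] at h
    rw [div_le_iff₀ hε]
    linarith

/-- A quadratic polynomial which is `o(ε)` at `0` cannot eventually dominate every multiple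
of `ε ^ 2`. -/
lemma not_eventually_ge_of_quadratic {V : ℝ → ℝ} {A B D : ℝ}
    (hV : V =ᶠ[𝓝[>] 0] fun ε => A * ε ^ 2 + B * ε + D)
    (hsmall : Tendsto (fun ε => V ε / ε) (𝓝[>] 0) (𝓝 0)) :
    ¬ ∀ N : ℕ, ∀ᶠ ε in 𝓝[>] (0 : ℝ), N * (ε / 2) ^ 2 ≤ V ε := by
  intro hbig
  have hid : Tendsto (fun ε : ℝ => ε) (𝓝[>] 0) (𝓝 0) := nhdsWithin_le_nhds
  have hD : D = 0 := by
    have h1 : Tendsto (fun ε => V ε / ε * ε) (𝓝[>] 0) (𝓝 0) := by simpa using hsmall.mul hid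
    have h2 : Tendsto (fun ε : ℝ => A * ε ^ 2 + B * ε + D) (𝓝[>] 0) (𝓝 D) := by
      simpa using (((hid.pow 2).const_mul A).add (hid.const_mul B)).add_const D
    refine tendsto_nhds_unique (h2.congr' ?_) h1
    filter_upwards [hV, self_mem_nhdsWithin] with ε h (hε : 0 < ε)
    rw [div_mul_cancel₀ _ hε.ne', h]
  have hB : B = 0 := by
    have h2 : Tendsto (fun ε : ℝ => A * ε + B) (𝓝[>] 0) (𝓝 B) := by
      simpa using (hid.const_mul A).add_const B
    refine tendsto_nhds_unique (h2.congr' ?_) hsmall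
    filter_upwards [hV, self_mem_nhdsWithin] with ε h (hε : 0 < ε)
    rw [h, hD]; field_simp; ring
  obtain ⟨N, hN⟩ := exists_nat_gt (4 * A)
  obtain ⟨ε, ⟨h1, h2⟩, hε⟩ := (((hbig N).and hV).and self_mem_nhdsWithin).exists
  have hε' : 0 < ε ^ 2 := pow_pos hε 2
  rw [h2, hB, hD] at h1
  nlinarith

/-- For `r > 2` the Cantor dust `C^r` is not pluriphase with respect to
`Γ = (0,1)² \ S((0,1)²)`: with `g = sup_{x ∈ Γ} dist(x, C^r)`, there is no finite partition
`0 = a₀ < a₁ < … < a_M = g` and constants `κ_{m,k}` such that for every `ε > 0`,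
`λ²((C^r)_ε ∩ Γ) = Σ_{m=1}^M 1_{(a_{m-1},a_m]}(ε) Σ_{k=0}^2 κ_{m,k} ε^(2-k) + 1_{(g,∞)}(ε) λ²(Γ)`. -/
theorem stmt_1 (r : ℝ) (hr : 2 < r) (C : Set (EuclideanSpace ℝ (Fin 2)))
    (hC : IsCantorDust r C)
    (g : ℝ) (hg : g = ⨆ x : Gamma r, infDist (x : EuclideanSpace ℝ (Fin 2)) C) :
    ¬ ∃ (M : ℕ) (a : ℕ → ℝ) (κ : ℕ → ℕ → ℝ),
        1 ≤ M ∧ a 0 = 0 ∧ a M = g ∧ (∀ m < M, a m < a (m + 1)) ∧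
        ∀ ε : ℝ, 0 < ε →
          (volume (cthickening ε C ∩ Gamma r)).toReal =
            (∑ m ∈ Finset.Icc 1 M,
              Set.indicator (Set.Ioc (a (m - 1)) (a m)) (fun _ => (1 : ℝ)) ε *
                ∑ k ∈ Finset.range 3, κ m k * ε ^ ((2 : ℝ) - (k : ℝ))) +
            Set.indicator (Set.Ioi g) (fun _ => (1 : ℝ)) ε * (volume (Gamma r)).toReal := by
  rintro ⟨M, a, κ, hM, ha0, haM, hlt, hV⟩
  have hmono : ∀ m n, m ≤ n → n ≤ M → a m ≤ a n := by
    intro m n hmn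
    induction n, hmn using Nat.le_induction with
    | base => exact fun _ => le_rfl
    | succ n _ ih => exact fun hn => (ih (by lia)).trans (hlt n (by lia)).le
  have ha1 : 0 < a 1 := by simpa [ha0] using hlt 0 hM
  refine not_eventually_ge_of_quadratic (A := κ 1 0) (B := κ 1 1) (D := κ 1 2) ?_
    (hC.tendsto_volume_div hr) (hC.eventually_le_volume hr)
  filter_upwards [Ioo_mem_nhdsGT ha1] with ε ⟨hε, hεa⟩
  rw [hV ε hε, Finset.sum_eq_single_of_mem 1 (by simpa using hM), indicator_of_mem,
    indicator_of_notMem]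
  · have e0 : ε ^ (2 : ℝ) = ε ^ 2 := Real.rpow_two ε
    have e1 : ((2 : ℝ) - 1) = 1 := by norm_num
    simp [Finset.sum_range_succ, e0, e1]
  · rw [mem_Ioi, not_lt, ← haM]
    exact hεa.le.trans (hmono 1 M hM le_rfl)
  · simpa [ha0] using ⟨hε, hεa.le⟩
  · intro m hm hm1
    rw [Finset.mem_Icc] at hm
    rw [indicator_of_notMem, zero_mul]
    intro h
    exact (hεa.le.trans (hmono 1 (m - 1) (by lia) (by lia))).not_gt h.1
end

section
/- Let r ≥ 30 be a real number. Then for every n ∈ ℕ, with ε = √(1/2)·r^(−n), the area of the ε-parallel set of the Cantor dust C^r satisfies the lower bound λ²((C^r)_ε) > 4^n · r^(−2n) · (1 + 3·√(1/2) + π/2). -/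
open MeasureTheory Metric Set Real Filter Topology ENNReal

/-- The vertex of the unit square with coordinates `0` or `1` prescribed by `σ`. -/
noncomputable def corner (σ : Fin 2 → Bool) : EuclideanSpace ℝ (Fin 2) :=
  WithLp.toLp 2 fun i => if σ i then 1 else 0

lemma homothety_apply_coord (p x : EuclideanSpace ℝ (Fin 2)) (c : ℝ) (i : Fin 2) :
    AffineMap.homothety p c x i = c * (x i - p i) + p i := by
  simp [AffineMap.homothety_apply]

lemma cantorMap_eq_homothety {r : ℝ} (hr : r ≠ 0) (σ : Fin 2 → Bool) :
    cantorMap r (if σ 0 then (r - 1) / r else 0) (if σ 1 then (r - 1) / r else 0) =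
      AffineMap.homothety (corner σ) r⁻¹ := by
  ext x i
  rw [homothety_apply_coord]
  fin_cases i
  · cases h : σ 0 <;> simp [cantorMap, corner, h]
    field_simp
    ring
  · cases h : σ 1 <;> simp [cantorMap, corner, h]
    field_simp
    ring

lemma IsCantorDust.eq_iUnion {r : ℝ} (hr : r ≠ 0) {C : Set (EuclideanSpace ℝ (Fin 2))}
    (hC : IsCantorDust r C) :
    C = ⋃ σ : Fin 2 → Bool, AffineMap.homothety (corner σ) r⁻¹ '' C := by
  have h := hC.2.2
  have h00 := cantorMap_eq_homothety hr ![false, false]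
  have h10 := cantorMap_eq_homothety hr ![true, false]
  have h11 := cantorMap_eq_homothety hr ![true, true]
  have h01 := cantorMap_eq_homothety hr ![false, true]
  simp at h00 h10 h11 h01
  rw [h00, h10, h11, h01] at h
  apply Subset.antisymm
  · intro x hx
    rw [h] at hx
    rcases hx with ((hx | hx) | hx) | hx <;> exact mem_iUnion_of_mem _ hx
  · refine iUnion_subset fun σ => ?_
    have hσ : σ = ![σ 0, σ 1] := by ext i; fin_cases i <;> rfl
    intro x hx
    rw [h]
    rw [hσ] at hx
    cases h0 : σ 0 <;> cases h1 : σ 1 <;> rw [h0, h1] at hx <;>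
      simp only [mem_union, hx, true_or, or_true]

lemma IsCantorDust.homothety_mem {r : ℝ} (hr : r ≠ 0) {C : Set (EuclideanSpace ℝ (Fin 2))}
    (hC : IsCantorDust r C) (σ : Fin 2 → Bool) {x : EuclideanSpace ℝ (Fin 2)} (hx : x ∈ C) :
    AffineMap.homothety (corner σ) r⁻¹ x ∈ C := by
  rw [hC.eq_iUnion hr]
  exact mem_iUnion_of_mem σ (mem_image_of_mem _ hx)

lemma IsCantorDust.corner_mem {r : ℝ} (hr : 1 < r) {C : Set (EuclideanSpace ℝ (Fin 2))}
    (hC : IsCantorDust r C) (σ : Fin 2 → Bool) : corner σ ∈ C := by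
  obtain ⟨x, hx, hmin⟩ := hC.1.exists_isMinOn hC.2.1
    (f := fun x => dist x (corner σ)) (by fun_prop)
  have h : dist x (corner σ) ≤ dist (AffineMap.homothety (corner σ) r⁻¹ x) (corner σ) :=
    hmin (hC.homothety_mem (by positivity) σ hx)
  rw [dist_homothety_center, dist_comm (corner σ), Real.norm_eq_abs,
    abs_of_pos (by positivity)] at h
  have hr1 : r⁻¹ < 1 := inv_lt_one_of_one_lt₀ hr
  have h0 : dist x (corner σ) = 0 := by nlinarith [dist_nonneg (x := x) (y := corner σ)]
  rwa [← dist_eq_zero.1 h0]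

lemma corner_apply_mem (σ : Fin 2 → Bool) (i : Fin 2) : corner σ i ∈ Icc (0 : ℝ) 1 := by
  cases h : σ i <;> simp [corner, h]

/-- The Cantor dust lies in the unit square. -/
lemma IsCantorDust.apply_mem_Icc {r : ℝ} (hr : 1 < r) {C : Set (EuclideanSpace ℝ (Fin 2))}
    (hC : IsCantorDust r C) {x : EuclideanSpace ℝ (Fin 2)} (hx : x ∈ C) (i : Fin 2) :
    x i ∈ Icc (0 : ℝ) 1 := by
  have hr1 : r⁻¹ < 1 := inv_lt_one_of_one_lt₀ hr
  have hr0 : 0 < r⁻¹ := by positivity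
  have preimage : ∀ y ∈ C, ∃ z ∈ C, ∃ q ∈ Icc (0 : ℝ) 1, y i = r⁻¹ * (z i - q) + q := by
    intro y hy
    rw [hC.eq_iUnion (by positivity)] at hy
    obtain ⟨σ, z, hz, rfl⟩ := mem_iUnion.1 hy
    exact ⟨z, hz, _, corner_apply_mem σ i, homothety_apply_coord _ _ _ _⟩
  constructor
  · obtain ⟨y, hy, hmin⟩ := hC.1.exists_isMinOn hC.2.1 (f := fun x => x i) (by fun_prop)
    obtain ⟨z, hz, q, hq, h⟩ := preimage y hy
    have h1 : y i ≤ z i := hmin hz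
    have h2 : y i ≤ x i := hmin hx
    have := hq.1
    by_contra! hneg
    nlinarith
  · obtain ⟨y, hy, hmax⟩ := hC.1.exists_isMaxOn hC.2.1 (f := fun x => x i) (by fun_prop)
    obtain ⟨z, hz, q, hq, h⟩ := preimage y hy
    have h1 : z i ≤ y i := hmax hz
    have h2 : x i ≤ y i := hmax hx
    have := hq.2
    by_contra! hgt
    nlinarith

lemma IsCantorDust.apply_mem_Icc_of_mem_cthickening {r : ℝ} (hr : 1 < r)
    {C : Set (EuclideanSpace ℝ (Fin 2))} (hC : IsCantorDust r C) {δ : ℝ} (hδ : 0 ≤ δ)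
    {x : EuclideanSpace ℝ (Fin 2)} (hx : x ∈ cthickening δ C) (i : Fin 2) :
    x i ∈ Icc (-δ) (1 + δ) := by
  rw [hC.1.cthickening_eq_biUnion_closedBall hδ] at hx
  obtain ⟨y, hy, hxy⟩ := mem_iUnion₂.1 hx
  have h1 := (PiLp.norm_apply_le (x - y) i).trans (mem_closedBall_iff_norm.1 hxy)
  rw [Real.norm_eq_abs, PiLp.sub_apply, abs_le] at h1
  have h2 := hC.apply_mem_Icc hr hy i
  constructor <;> linarith [h2.1, h2.2]

lemma IsCantorDust.image_homothety_cthickening_subset {r : ℝ} (hr : 1 < r)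
    {C : Set (EuclideanSpace ℝ (Fin 2))} (hC : IsCantorDust r C) {δ : ℝ} (hδ : 0 ≤ δ)
    (σ : Fin 2 → Bool) :
    AffineMap.homothety (corner σ) r⁻¹ '' cthickening δ C ⊆ cthickening (δ * r⁻¹) C := by
  rintro _ ⟨x, hx, rfl⟩
  rw [hC.1.cthickening_eq_biUnion_closedBall hδ] at hx
  obtain ⟨y, hy, hxy⟩ := mem_iUnion₂.1 hx
  refine mem_cthickening_of_dist_le _ _ _ _ (hC.homothety_mem (by positivity) σ hy) ?_
  have : AffineMap.homothety (corner σ) r⁻¹ x - AffineMap.homothety (corner σ) r⁻¹ y =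
      r⁻¹ • (x - y) := by
    simp only [AffineMap.homothety_apply, vsub_eq_sub, vadd_eq_add]
    module
  rw [dist_eq_norm, this, norm_smul, Real.norm_eq_abs, abs_of_pos (by positivity), mul_comm,
    ← dist_eq_norm]
  exact mul_le_mul_of_nonneg_right hxy (by positivity)

lemma IsCantorDust.volume_cthickening_ne_top {r : ℝ} {C : Set (EuclideanSpace ℝ (Fin 2))}
    (hC : IsCantorDust r C) (δ : ℝ) : volume (cthickening δ C) ≠ ∞ :=
  hC.1.cthickening.measure_ne_top

/-- The parallel set of the Cantor dust contains four disjoint scaled copies of the parallel set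
with an `r` times larger radius. -/
lemma IsCantorDust.mul_volume_cthickening_le {r : ℝ} {C : Set (EuclideanSpace ℝ (Fin 2))}
    (hC : IsCantorDust r C) {δ : ℝ} (hδ : 0 ≤ δ) (hr : 2 + 2 * δ < r) :
    4 * r⁻¹ ^ 2 * volume.real (cthickening δ C) ≤ volume.real (cthickening (δ * r⁻¹) C) := by
  have hr1 : 1 < r := by linarith
  have hr0 : 0 < r⁻¹ := by positivity
  have hne := hC.volume_cthickening_ne_top δ
  let P (σ : Fin 2 → Bool) := AffineMap.homothety (corner σ) r⁻¹ '' cthickening δ C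
  have hvol (σ) : volume.real (P σ) = r⁻¹ ^ 2 * volume.real (cthickening δ C) := by
    simp only [P, Measure.real, Measure.addHaar_image_homothety, finrank_euclideanSpace,
      Fintype.card_fin, ENNReal.toReal_mul]
    rw [ENNReal.toReal_ofReal (abs_nonneg _), abs_of_pos (by positivity)]
  have hP (σ : Fin 2 → Bool) : P σ ⊆ cthickening (δ * r⁻¹) C :=
    hC.image_homothety_cthickening_subset hr1 hδ σ
  have hcomp (σ) : IsCompact (P σ) :=
    hC.1.cthickening.image (AffineMap.homothety_continuous (corner σ) r⁻¹)
  have hdisj : Pairwise (Function.onFun Disjoint P) := by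
    intro σ τ hne
    obtain ⟨i, hi⟩ := Function.ne_iff.1 hne
    rw [Function.onFun, Set.disjoint_left]
    rintro _ ⟨x, hx, rfl⟩ ⟨y, hy, hyx⟩
    have hx := hC.apply_mem_Icc_of_mem_cthickening hr1 hδ hx i
    have hy := hC.apply_mem_Icc_of_mem_cthickening hr1 hδ hy i
    have h := congrArg (fun z : EuclideanSpace ℝ (Fin 2) => r * z i) hyx
    simp only [homothety_apply_coord, mul_add, mul_inv_cancel_left₀ (by positivity : r ≠ 0)] at h
    cases h0 : σ i <;> cases h1 : τ i <;> simp [corner, h0, h1] at h hi <;>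
      linarith [hx.1, hx.2, hy.1, hy.2]
  calc 4 * r⁻¹ ^ 2 * volume.real (cthickening δ C) = ∑ σ, volume.real (P σ) := by
        simp only [hvol, Finset.sum_const, Finset.card_univ, Fintype.card_fun, Fintype.card_bool,
          Fintype.card_fin, nsmul_eq_mul]
        norm_num
        ring
    _ = volume.real (⋃ σ, P σ) :=
        (measureReal_iUnion_fintype hdisj (fun σ => (hcomp σ).measurableSet)
          (fun σ => (hcomp σ).measure_ne_top)).symm
    _ ≤ volume.real (cthickening (δ * r⁻¹) C) :=
        measureReal_mono (iUnion_subset hP) (hC.volume_cthickening_ne_top _)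

lemma IsCantorDust.pow_mul_volume_cthickening_le {r : ℝ} {C : Set (EuclideanSpace ℝ (Fin 2))}
    (hC : IsCantorDust r C) {δ : ℝ} (hδ : 0 ≤ δ) (hr : 2 + 2 * δ < r) (n : ℕ) :
    (4 * r⁻¹ ^ 2) ^ n * volume.real (cthickening δ C) ≤
      volume.real (cthickening (δ * r⁻¹ ^ n) C) := by
  have hr0 : 0 < r := by linarith
  induction n with
  | zero => simp
  | succ n ih =>
    have hle : δ * r⁻¹ ^ n ≤ δ :=
      mul_le_of_le_one_right hδ (pow_le_one₀ (by positivity) (inv_le_one_of_one_le₀ (by linarith)))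
    calc (4 * r⁻¹ ^ 2) ^ (n + 1) * volume.real (cthickening δ C)
        = 4 * r⁻¹ ^ 2 * ((4 * r⁻¹ ^ 2) ^ n * volume.real (cthickening δ C)) := by ring
      _ ≤ 4 * r⁻¹ ^ 2 * volume.real (cthickening (δ * r⁻¹ ^ n) C) := by gcongr
      _ ≤ volume.real (cthickening (δ * r⁻¹ ^ n * r⁻¹) C) :=
        hC.mul_volume_cthickening_le (by positivity) (by linarith)
      _ = volume.real (cthickening (δ * r⁻¹ ^ (n + 1)) C) := by rw [pow_succ, mul_assoc]

/-- The part of the disk of radius `√(1/2)` about the origin cut off by the side of the inscribed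
square in direction `i`; the Boolean selects one of the two opposite sides. -/
def diskCap (i : Fin 2) (b : Bool) : Set (EuclideanSpace ℝ (Fin 2)) :=
  ball 0 √(1 / 2) ∩ {x | if b then x i < -(1 / 2) else 1 / 2 ≤ x i}

lemma measurableSet_diskCap (i : Fin 2) (b : Bool) : MeasurableSet (diskCap i b) := by
  refine measurableSet_ball.inter ?_
  have h : Measurable fun x : EuclideanSpace ℝ (Fin 2) => x i := by fun_prop
  cases b
  · simpa using measurableSet_le measurable_const h
  · simpa using measurableSet_lt h measurable_const

lemma mem_ball_sqrt_half {x : EuclideanSpace ℝ (Fin 2)} :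
    x ∈ ball 0 √(1 / 2) ↔ x 0 ^ 2 + x 1 ^ 2 < 1 / 2 := by
  rw [mem_ball_zero_iff, EuclideanSpace.norm_eq, Real.sqrt_lt_sqrt_iff (by positivity)]
  simp

lemma volume_real_ball_sqrt_half :
    volume.real (ball (0 : EuclideanSpace ℝ (Fin 2)) √(1 / 2)) = π / 2 := by
  rw [Measure.real, EuclideanSpace.volume_ball_fin_two, ← ENNReal.ofReal_pow (by positivity),
    Real.sq_sqrt (by norm_num)]
  simp [Real.pi_pos.le]
  ring

/-- The four caps of the disk of radius `√(1/2)` outside its inscribed unit square. -/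
lemma sum_volume_diskCap_le :
    ∑ p : Fin 2 × Bool, volume.real (diskCap p.1 p.2) ≤ π / 2 - 1 := by
  let Q : Set (EuclideanSpace ℝ (Fin 2)) :=
    (WithLp.ofLp : EuclideanSpace ℝ (Fin 2) → Fin 2 → ℝ) ⁻¹'
      Set.pi univ fun _ => Ioo (-(1 / 2)) (1 / 2)
  have hQm : MeasurableSet Q :=
    (MeasurableSet.univ_pi fun _ => measurableSet_Ioo).preimage (by fun_prop)
  have hQ : volume.real Q = 1 := by
    rw [Measure.real, (PiLp.volume_preserving_ofLp (Fin 2)).measure_preimage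
      (MeasurableSet.univ_pi fun _ => measurableSet_Ioo).nullMeasurableSet, Real.volume_pi_Ioo]
    norm_num
  have hQball : Q ⊆ ball 0 √(1 / 2) := by
    intro x hx
    have h0 := hx 0 (mem_univ _)
    have h1 := hx 1 (mem_univ _)
    rw [mem_ball_sqrt_half]
    nlinarith [h0.1, h0.2, h1.1, h1.2]
  have hsub : ⋃ p : Fin 2 × Bool, diskCap p.1 p.2 ⊆ ball 0 √(1 / 2) \ Q := by
    refine iUnion_subset fun p x hx => ⟨hx.1, fun hxQ => ?_⟩
    have h := hxQ p.1 (mem_univ _)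
    have h' := hx.2
    rw [mem_ofPred_eq] at h'
    split_ifs at h' <;> linarith [h.1, h.2]
  have hdisj : Pairwise (Function.onFun Disjoint fun p : Fin 2 × Bool => diskCap p.1 p.2) := by
    rintro ⟨i, b⟩ ⟨j, c⟩ hne
    rw [Function.onFun, Set.disjoint_left]
    intro x hx hx'
    have h := mem_ball_sqrt_half.1 hx.1
    have h1 := hx.2
    have h2 := hx'.2
    rw [mem_ofPred_eq] at h1 h2
    fin_cases i <;> fin_cases j <;> cases b <;> cases c <;> simp at h1 h2 hne <;> nlinarith
  rw [← measureReal_iUnion_fintype hdisj (fun p => measurableSet_diskCap _ _)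
    (fun p => measure_ne_top_of_subset inter_subset_left measure_ball_lt_top.ne),
    ← volume_real_ball_sqrt_half]
  nth_rewrite 2 [← hQ]
  rw [← measureReal_sdiff hQball hQm measure_ball_lt_top.ne]
  exact measureReal_mono hsub (measure_ne_top_of_subset sdiff_subset measure_ball_lt_top.ne)

/-- The disks of radius `√(1/2)` about the vertices of the unit square have a union of area at
least `π + 2`. -/
lemma IsCantorDust.pi_add_two_le_volume {r : ℝ} (hr : 1 < r)
    {C : Set (EuclideanSpace ℝ (Fin 2))} (hC : IsCantorDust r C) :
    π + 2 ≤ volume.real (cthickening √(1 / 2) C) := by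
  let D (σ : Fin 2 → Bool) : Set (EuclideanSpace ℝ (Fin 2)) :=
    ball 0 √(1 / 2) \ (diskCap 0 (σ 0) ∪ diskCap 1 (σ 1))
  let A (σ : Fin 2 → Bool) := (fun x => corner σ + x) '' D σ
  have hcap (i b) : volume (diskCap i b) ≠ ∞ :=
    measure_ne_top_of_subset inter_subset_left measure_ball_lt_top.ne
  have hDm (σ) : MeasurableSet (D σ) :=
    measurableSet_ball.diff ((measurableSet_diskCap _ _).union (measurableSet_diskCap _ _))
  have hAm (σ) : MeasurableSet (A σ) :=
    (MeasurableEquiv.addLeft (corner σ)).measurableSet_image.2 (hDm σ)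
  have hsub (σ) : A σ ⊆ cthickening √(1 / 2) C := by
    rintro _ ⟨x, hx, rfl⟩
    refine mem_cthickening_of_dist_le _ _ _ _ (hC.corner_mem hr σ) ?_
    simpa using (mem_ball_zero_iff.1 hx.1).le
  have hvol (σ) : π / 2 - (volume.real (diskCap 0 (σ 0)) + volume.real (diskCap 1 (σ 1))) ≤
      volume.real (A σ) := by
    have h1 : volume.real (A σ) = volume.real (D σ) := by
      simp only [A, Measure.real, image_add_left, measure_preimage_add]
    rw [h1, ← volume_real_ball_sqrt_half]
    refine le_trans ?_ (le_measureReal_sdiff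
      (measure_union_lt_top (hcap _ _).lt_top (hcap _ _).lt_top).ne)
    exact sub_le_sub_left (measureReal_union_le _ _) _
  have hside (σ : Fin 2 → Bool) {x} (hx : x ∈ A σ) (i : Fin 2) :
      if σ i then 1 / 2 ≤ x i else x i < 1 / 2 := by
    obtain ⟨y, hy, rfl⟩ := hx
    have h : y ∉ diskCap i (σ i) := by
      intro hyi
      apply hy.2
      fin_cases i
      · exact Or.inl hyi
      · exact Or.inr hyi
    have h' := fun hh => h ⟨hy.1, hh⟩
    rw [mem_ofPred_eq] at h'
    cases hσ : σ i <;> simp [corner, hσ] at h' ⊢ <;> linarith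
  have hdisj : Pairwise (Function.onFun Disjoint A) := by
    intro σ τ hne
    obtain ⟨i, hi⟩ := Function.ne_iff.1 hne
    rw [Function.onFun, Set.disjoint_left]
    intro x hx hx'
    have h := hside σ hx i
    have h' := hside τ hx' i
    cases h0 : σ i <;> cases h1 : τ i <;> simp [h0, h1] at h h' hi <;> linarith
  have hsum : π + 2 ≤ ∑ σ : Fin 2 → Bool,
      (π / 2 - (volume.real (diskCap 0 (σ 0)) + volume.real (diskCap 1 (σ 1)))) := by
    have h := sum_volume_diskCap_le
    rw [← (finTwoArrowEquiv Bool).symm.sum_comp]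
    simp only [Fintype.sum_prod_type, Fintype.sum_bool, Fin.sum_univ_two,
      finTwoArrowEquiv_symm_apply, Matrix.cons_val_zero, Matrix.cons_val_one] at h ⊢
    linarith
  calc π + 2 ≤ ∑ σ, volume.real (A σ) := hsum.trans (Finset.sum_le_sum fun σ _ => hvol σ)
    _ = volume.real (⋃ σ, A σ) :=
        (measureReal_iUnion_fintype hdisj hAm fun σ =>
          measure_ne_top_of_subset (hsub σ) (hC.volume_cthickening_ne_top _)).symm
    _ ≤ volume.real (cthickening √(1 / 2) C) :=
        measureReal_mono (iUnion_subset hsub) (hC.volume_cthickening_ne_top _)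

/-- For `r ≥ 30` and every `n ∈ ℕ`, with `ε = √(1/2)·r^(-n)`,
`λ²((C^r)_ε) > 4^n · r^(-2n) · (1 + 3√(1/2) + π/2)`. -/
theorem stmt_5 (r : ℝ) (hr : 30 ≤ r) (C : Set (EuclideanSpace ℝ (Fin 2)))
    (hC : IsCantorDust r C) (n : ℕ) :
    4 ^ n * r ^ (-(2 * (n : ℝ))) * (1 + 3 * Real.sqrt (1 / 2) + π / 2) <
      (volume (cthickening (Real.sqrt (1 / 2) * r ^ (-(n : ℝ))) C)).toReal := by
  have hr0 : 0 < r := by linarith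
  have hs : √(1 / 2) ≤ 3 / 4 := by
    rw [Real.sqrt_le_left (by norm_num)]
    norm_num
  have hpow : r ^ (-(n : ℝ)) = r⁻¹ ^ n := by
    rw [Real.rpow_neg hr0.le, Real.rpow_natCast, inv_pow]
  have hpow2 : 4 ^ n * r ^ (-(2 * (n : ℝ))) = (4 * r⁻¹ ^ 2) ^ n := by
    rw [mul_pow, ← pow_mul, Real.rpow_neg hr0.le, inv_pow]
    congr 2
    exact_mod_cast Real.rpow_natCast r (2 * n)
  rw [hpow, hpow2]
  have hbase := hC.pi_add_two_le_volume (by linarith)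
  refine lt_of_lt_of_le (mul_lt_mul_of_pos_left ?_ (by positivity))
    (hC.pow_mul_volume_cthickening_le (Real.sqrt_nonneg _) (by linarith) n)
  linarith [Real.pi_gt_three]
end

section
/- Let r > 2, n ∈ ℕ, and 0 < ε ≤ ((r−2)/2)·r^(−n). Then the area of the ε-parallel set of the Cantor dust satisfies the exact scaling relation λ²((C^r)_ε) = 4^n · r^(−2n) · λ²((C^r)_{r^n ε}). (Equivalently, the ε-parallel sets of the 4^n level-n pieces S_w(C^r), w ∈ {1,2,3,4}^n, cover (C^r)_ε and pairwise overlap only in Lebesgue-null sets, and each is a scaled copy S_w((C^r)_{r^n ε}).) -/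
open MeasureTheory Metric Set Real Filter Topology ENNReal

lemma cantorMap_apply (r a b : ℝ) (x : EuclideanSpace ℝ (Fin 2)) (i : Fin 2) :
    cantorMap r a b x i = r⁻¹ * x i + ![a, b] i := by
  simp [cantorMap]

lemma continuous_cantorMap (r a b : ℝ) : Continuous (cantorMap r a b) := by
  unfold cantorMap
  fun_prop

lemma dist_cantorMap {r : ℝ} (hr : 0 < r) (a b : ℝ) (x y : EuclideanSpace ℝ (Fin 2)) :
    dist (cantorMap r a b x) (cantorMap r a b y) = r⁻¹ * dist x y := by
  rw [cantorMap, cantorMap, dist_add_right, dist_smul₀, Real.norm_of_nonneg (inv_pos.2 hr).le]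

lemma surjective_cantorMap {r : ℝ} (hr : 0 < r) (a b : ℝ) :
    Function.Surjective (cantorMap r a b) := fun y => by
  refine ⟨r • (y - (WithLp.equiv 2 (Fin 2 → ℝ)).symm ![a, b]), ?_⟩
  rw [cantorMap, inv_smul_smul₀ hr.ne', sub_add_cancel]

lemma IsCompact.mem_cthickening_iff {α : Type*} [PseudoMetricSpace α] {A : Set α}
    (hA : IsCompact A) {δ : ℝ} (hδ : 0 ≤ δ) (x : α) :
    x ∈ cthickening δ A ↔ ∃ a ∈ A, dist x a ≤ δ := by
  simp [hA.cthickening_eq_biUnion_closedBall hδ]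

lemma cthickening_image_cantorMap {r : ℝ} (hr : 0 < r) (a b : ℝ)
    {C : Set (EuclideanSpace ℝ (Fin 2))} (hC : IsCompact C) {δ : ℝ} (hδ : 0 ≤ δ) :
    cthickening δ (cantorMap r a b '' C) = cantorMap r a b '' cthickening (r * δ) C := by
  ext x
  obtain ⟨y, rfl⟩ := surjective_cantorMap hr a b x
  have key (c : EuclideanSpace ℝ (Fin 2)) :
      dist (cantorMap r a b y) (cantorMap r a b c) ≤ δ ↔ dist y c ≤ r * δ := by
    rw [dist_cantorMap hr, inv_mul_le_iff₀ hr]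
  have hinj : Function.Injective (cantorMap r a b) := fun u v huv => by
    have h := dist_cantorMap hr a b u v
    rw [huv, dist_self, eq_comm, mul_eq_zero] at h
    exact dist_eq_zero.1 (h.resolve_left (inv_pos.2 hr).ne')
  rw [(hC.image (continuous_cantorMap r a b)).mem_cthickening_iff hδ, hinj.mem_set_image,
    hC.mem_cthickening_iff (mul_nonneg hr.le hδ)]
  simp [key]

lemma volume_image_cantorMap (r a b : ℝ) (T : Set (EuclideanSpace ℝ (Fin 2))) :
    volume (cantorMap r a b '' T) = ENNReal.ofReal ((r ^ 2)⁻¹) * volume T := by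
  have h : cantorMap r a b '' T =
      (fun x => x + (WithLp.equiv 2 (Fin 2 → ℝ)).symm ![a, b]) '' ((fun x => r⁻¹ • x) '' T) := by
    rw [image_image]; rfl
  rw [h, image_add_right, measure_preimage_add_right, image_smul, Measure.addHaar_smul,
    finrank_euclideanSpace_fin, inv_pow, abs_of_nonneg (by positivity)]

lemma volume_coordinate_hyperplane (i : Fin 2) (c : ℝ) :
    volume {x : EuclideanSpace ℝ (Fin 2) | x i = c} = 0 := by
  have h := (PiLp.volume_preserving_ofLp (Fin 2)).measure_preimage
    (s := {f : Fin 2 → ℝ | f i = c})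
    (measurableSet_eq_fun (measurable_pi_apply i) measurable_const).nullMeasurableSet
  rw [volume_pi, Measure.pi_hyperplane] at h
  exact h

lemma volume_union_of_separated {A B : Set (EuclideanSpace ℝ (Fin 2))} (i : Fin 2) (c : ℝ)
    (hB : MeasurableSet B) (hAc : ∀ x ∈ A, x i ≤ c) (hBc : ∀ x ∈ B, c ≤ x i) :
    volume (A ∪ B) = volume A + volume B :=
  measure_union₀ hB.nullMeasurableSet <|
    measure_mono_null (fun x hx => le_antisymm (hAc x hx.1) (hBc x hx.2))
      (volume_coordinate_hyperplane i c)

lemma IsCantorDust.exists_preimage {r : ℝ} {C : Set (EuclideanSpace ℝ (Fin 2))}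
    (hC : IsCantorDust r C) {x : EuclideanSpace ℝ (Fin 2)} (hx : x ∈ C) (i : Fin 2) :
    ∃ y ∈ C, x i = r⁻¹ * y i ∨ x i = r⁻¹ * y i + (r - 1) / r := by
  rw [hC.2.2] at hx
  obtain ((⟨y, hy, rfl⟩ | ⟨y, hy, rfl⟩) | ⟨y, hy, rfl⟩) | ⟨y, hy, rfl⟩ := hx <;>
    refine ⟨y, hy, ?_⟩ <;> fin_cases i <;> simp [cantorMap_apply]

lemma IsCantorDust.coordinate_mem_Icc {r : ℝ} (hr : 1 < r)
    {C : Set (EuclideanSpace ℝ (Fin 2))} (hC : IsCantorDust r C)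
    {x : EuclideanSpace ℝ (Fin 2)} (hx : x ∈ C) (i : Fin 2) : x i ∈ Icc 0 1 := by
  have hcont : ContinuousOn (fun x : EuclideanSpace ℝ (Fin 2) => x i) C := by fun_prop
  have h0 : r⁻¹ < 1 := inv_lt_one_of_one_lt₀ hr
  have hdiv : (r - 1) / r = 1 - r⁻¹ := by field_simp
  constructor
  · obtain ⟨m, hm, hmin⟩ := hC.1.exists_isMinOn hC.2.1 hcont
    refine le_trans ?_ (hmin hx)
    obtain ⟨y, hy, h⟩ := hC.exists_preimage hm i
    have hy' : m i ≤ y i := hmin hy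
    have : r⁻¹ * m i ≤ r⁻¹ * y i := by gcongr
    change 0 ≤ m i
    rcases h with h | h <;> nlinarith
  · obtain ⟨m, hm, hmax⟩ := hC.1.exists_isMaxOn hC.2.1 hcont
    refine le_trans (hmax hx) ?_
    obtain ⟨y, hy, h⟩ := hC.exists_preimage hm i
    have hy' : y i ≤ m i := hmax hy
    have : r⁻¹ * y i ≤ r⁻¹ * m i := by gcongr
    change m i ≤ 1
    rcases h with h | h <;> nlinarith

lemma IsCantorDust.coordinate_mem_Icc_of_mem_cthickening_image {r : ℝ} (hr : 2 < r)
    {C : Set (EuclideanSpace ℝ (Fin 2))} (hC : IsCantorDust r C) {δ : ℝ} (hδ : 0 ≤ δ)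
    (hδ' : δ ≤ (r - 2) / 2 * r⁻¹) (a b : ℝ) {x : EuclideanSpace ℝ (Fin 2)}
    (hx : x ∈ cthickening δ (cantorMap r a b '' C)) (i : Fin 2) :
    x i ∈ Icc (![a, b] i - (1 / 2 - r⁻¹)) (![a, b] i + 1 / 2) := by
  obtain ⟨_, ⟨c, hc, rfl⟩, hxc⟩ :=
    ((hC.1.image (continuous_cantorMap r a b)).mem_cthickening_iff hδ x).1 hx
  have hle := (PiLp.norm_apply_le (x - cantorMap r a b c) i).trans (dist_eq_norm x _ ▸ hxc)
  rw [PiLp.sub_apply, Real.norm_eq_abs, abs_le, cantorMap_apply] at hle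
  obtain ⟨hc0, hc1⟩ := hC.coordinate_mem_Icc (by linarith) hc i
  have hr0 : 0 < r⁻¹ := by positivity
  have hbound : (r - 2) / 2 * r⁻¹ = 1 / 2 - r⁻¹ := by field_simp
  constructor <;> nlinarith

lemma IsCantorDust.volume_cthickening_eq {r : ℝ} (hr : 2 < r)
    {C : Set (EuclideanSpace ℝ (Fin 2))} (hC : IsCantorDust r C) {δ : ℝ} (hδ : 0 ≤ δ)
    (hδ' : δ ≤ (r - 2) / 2 * r⁻¹) :
    volume (cthickening δ C) = 4 * ENNReal.ofReal ((r ^ 2)⁻¹) * volume (cthickening (r * δ) C) := by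
  have hr0 : 0 < r := by linarith
  have hdiv : (r - 1) / r = 1 - r⁻¹ := by field_simp
  have hloc (a b : ℝ) {x : EuclideanSpace ℝ (Fin 2)} :=
    hC.coordinate_mem_Icc_of_mem_cthickening_image hr hδ hδ' a b (x := x)
  have hvol (a b : ℝ) : volume (cthickening δ (cantorMap r a b '' C)) =
      ENNReal.ofReal ((r ^ 2)⁻¹) * volume (cthickening (r * δ) C) := by
    rw [cthickening_image_cantorMap hr0 a b hC.1 hδ, volume_image_cantorMap]
  have hmeas (a b : ℝ) : MeasurableSet (cthickening δ (cantorMap r a b '' C)) :=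
    isClosed_cthickening.measurableSet
  have hdecomp : cthickening δ C =
      (cthickening δ (cantorMap r 0 0 '' C) ∪ cthickening δ (cantorMap r 0 ((r - 1) / r) '' C)) ∪
      (cthickening δ (cantorMap r ((r - 1) / r) 0 '' C) ∪
        cthickening δ (cantorMap r ((r - 1) / r) ((r - 1) / r) '' C)) := by
    conv_lhs => rw [hC.2.2]
    simp only [cthickening_union]
    ac_rfl
  have hlow (i : Fin 2) (a b : ℝ) (h : ![a, b] i = 0) (x : EuclideanSpace ℝ (Fin 2))
      (hx : x ∈ cthickening δ (cantorMap r a b '' C)) : x i ≤ 1 / 2 := by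
    linarith [(hloc a b hx i).2]
  have hhigh (i : Fin 2) (a b : ℝ) (h : ![a, b] i = (r - 1) / r) (x : EuclideanSpace ℝ (Fin 2))
      (hx : x ∈ cthickening δ (cantorMap r a b '' C)) : 1 / 2 ≤ x i := by
    linarith [(hloc a b hx i).1]
  rw [hdecomp, volume_union_of_separated 0 (1 / 2) ((hmeas _ _).union (hmeas _ _))
      (fun x hx => hx.elim (hlow 0 _ _ rfl x) (hlow 0 _ _ rfl x))
      (fun x hx => hx.elim (hhigh 0 _ _ rfl x) (hhigh 0 _ _ rfl x)),
    volume_union_of_separated 1 (1 / 2) (hmeas _ _) (hlow 1 _ _ rfl) (hhigh 1 _ _ rfl),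
    volume_union_of_separated 1 (1 / 2) (hmeas _ _) (hlow 1 _ _ rfl) (hhigh 1 _ _ rfl)]
  simp only [hvol]
  ring

lemma IsCantorDust.volume_cthickening_eq_pow {r : ℝ} (hr : 2 < r)
    {C : Set (EuclideanSpace ℝ (Fin 2))} (hC : IsCantorDust r C) (n : ℕ) {ε : ℝ} (hε : 0 ≤ ε)
    (hε' : ε ≤ (r - 2) / 2 * (r ^ n)⁻¹) :
    volume (cthickening ε C) =
      (4 * ENNReal.ofReal ((r ^ 2)⁻¹)) ^ n * volume (cthickening (r ^ n * ε) C) := by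
  have hr0 : 0 < r := by linarith
  induction n generalizing ε with
  | zero => simp
  | succ n ih =>
    have hsucc : ε ≤ (r - 2) / 2 * (r ^ n)⁻¹ * r⁻¹ := by
      rwa [pow_succ, mul_inv, ← mul_assoc] at hε'
    have hone : ε ≤ (r - 2) / 2 * r⁻¹ := by
      refine hsucc.trans ?_
      have hinv : (r ^ n)⁻¹ ≤ 1 := inv_le_one_of_one_le₀ (one_le_pow₀ (by linarith))
      gcongr
      exact mul_le_of_le_one_right (by linarith) hinv
    have hscaled : r * ε ≤ (r - 2) / 2 * (r ^ n)⁻¹ := by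
      rwa [← div_eq_mul_inv _ r, le_div_iff₀' hr0] at hsucc
    rw [hC.volume_cthickening_eq hr hε hone, ih (by positivity) hscaled, ← mul_assoc (r ^ n),
      ← pow_succ, ← mul_assoc, ← pow_succ']

/-- For `r > 2`, `n ∈ ℕ` and `0 < ε ≤ ((r-2)/2)·r^(-n)`, the exact scaling relation
`λ²((C^r)_ε) = 4^n · r^(-2n) · λ²((C^r)_{r^n ε})` holds. -/
theorem stmt_8 (r : ℝ) (hr : 2 < r) (C : Set (EuclideanSpace ℝ (Fin 2)))
    (hC : IsCantorDust r C) (n : ℕ) (ε : ℝ) (hε : 0 < ε)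
    (hε' : ε ≤ (r - 2) / 2 * r ^ (-(n : ℝ))) :
    (volume (cthickening ε C)).toReal =
      4 ^ n * r ^ (-(2 * (n : ℝ))) * (volume (cthickening (r ^ (n : ℝ) * ε) C)).toReal := by
  have hr0 : 0 < r := by linarith
  rw [Real.rpow_neg hr0.le, Real.rpow_natCast] at hε'
  rw [hC.volume_cthickening_eq_pow hr n hε.le hε', Real.rpow_natCast, Real.rpow_neg hr0.le,
    Real.rpow_mul hr0.le, Real.rpow_natCast, Real.rpow_ofNat, ENNReal.toReal_mul,
    ENNReal.toReal_pow, ENNReal.toReal_mul, ENNReal.toReal_ofReal (by positivity), mul_pow, inv_pow]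
  simp
end
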